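/- arXiv:2504.00546 — 2 statements merged into one kernel-verified Lean document; each statement's English description precedes it below -/
import Mathlib

section
/- The six functions a0, a2, b0, b1, b2, b3, regarded as elements of the ℂ-algebra of all functions {τ ∈ ℍ : E4(τ) ≠ 0} × ℂ⁴ → ℂ, are algebraically independent over ℂ. -/
open MvPolynomial Complex

/-- `I2 = z1²+z2²+z3²+z4²` as a function on ℂ⁴ -/
noncomputable def fI2 (z : Fin 4 → ℂ) : ℂ := ∑ i, z i ^ 2

/-- `I4 = Σ_{i<j} zi²zj²` as a function on ℂ⁴ -/
noncomputable def fI4 (z : Fin 4 → ℂ) : ℂ :=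
  ∑ p ∈ Finset.univ.filter (fun p : Fin 4 × Fin 4 => p.1 < p.2), z p.1 ^ 2 * z p.2 ^ 2

/-- `I6 = Σ_{i<j<k} zi²zj²zk²` as a function on ℂ⁴ -/
noncomputable def fI6 (z : Fin 4 → ℂ) : ℂ :=
  ∑ p ∈ Finset.univ.filter (fun p : Fin 4 × Fin 4 × Fin 4 => p.1 < p.2.1 ∧ p.2.1 < p.2.2),
    z p.1 ^ 2 * z p.2.1 ^ 2 * z p.2.2 ^ 2

/-- `Ĩ4 = z1z2z3z4` as a function on ℂ⁴ -/
noncomputable def fI4t (z : Fin 4 → ℂ) : ℂ := ∏ i, z i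

/-- `T1 = I4/6 − I2²/24` -/
noncomputable def fT1 (z : Fin 4 → ℂ) : ℂ := fI4 z / 6 - fI2 z ^ 2 / 24

/-- `T2 = −I4/12 − Ĩ4/2 + I2²/48` -/
noncomputable def fT2 (z : Fin 4 → ℂ) : ℂ := -fI4 z / 12 - fI4t z / 2 + fI2 z ^ 2 / 48

/-- `T3 = −I4/12 + Ĩ4/2 + I2²/48` -/
noncomputable def fT3 (z : Fin 4 → ℂ) : ℂ := -fI4 z / 12 + fI4t z / 2 + fI2 z ^ 2 / 48

/-- `θ2(τ) = Σ_{n∈ℤ} q^{(n−1/2)²/2}`, `q = e^{2πiτ}` -/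
noncomputable def theta2 (τ : ℂ) : ℂ :=
  ∑' n : ℤ, Complex.exp (Real.pi * Complex.I * τ * ((n : ℂ) - 1 / 2) ^ 2)

/-- `θ3(τ) = Σ_{n∈ℤ} q^{n²/2}` -/
noncomputable def theta3 (τ : ℂ) : ℂ :=
  ∑' n : ℤ, Complex.exp (Real.pi * Complex.I * τ * (n : ℂ) ^ 2)

/-- `θ4(τ) = Σ_{n∈ℤ} (−1)ⁿ q^{n²/2}` -/
noncomputable def theta4 (τ : ℂ) : ℂ :=
  ∑' n : ℤ, (-1 : ℂ) ^ n * Complex.exp (Real.pi * Complex.I * τ * (n : ℂ) ^ 2)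

/-- `e1 = (θ3⁴+θ4⁴)/12` -/
noncomputable def e1 (τ : ℂ) : ℂ := (theta3 τ ^ 4 + theta4 τ ^ 4) / 12

/-- `e2 = (θ2⁴−θ4⁴)/12` -/
noncomputable def e2 (τ : ℂ) : ℂ := (theta2 τ ^ 4 - theta4 τ ^ 4) / 12

/-- `e3 = (−θ2⁴−θ3⁴)/12` -/
noncomputable def e3 (τ : ℂ) : ℂ := (-theta2 τ ^ 4 - theta3 τ ^ 4) / 12

/-- `K = I2` -/
noncomputable def Kf (_τ : ℂ) (z : Fin 4 → ℂ) : ℂ := fI2 z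

/-- `L = e1·T1 + e2·T2 + e3·T3` -/
noncomputable def Lf (τ : ℂ) (z : Fin 4 → ℂ) : ℂ :=
  e1 τ * fT1 z + e2 τ * fT2 z + e3 τ * fT3 z

/-- `M = 12(e1²·T1 + e2²·T2 + e3²·T3)` -/
noncomputable def Mf (τ : ℂ) (z : Fin 4 → ℂ) : ℂ :=
  12 * (e1 τ ^ 2 * fT1 z + e2 τ ^ 2 * fT2 z + e3 τ ^ 2 * fT3 z)

/-- `N = I6/4 − I2·I4/24 + I2³/96` -/
noncomputable def Nf (_τ : ℂ) (z : Fin 4 → ℂ) : ℂ :=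
  fI6 z / 4 - fI2 z * fI4 z / 24 + fI2 z ^ 3 / 96

/-- `q = e^{2πiτ}` -/
noncomputable def qc (τ : ℂ) : ℂ := Complex.exp (2 * Real.pi * Complex.I * τ)

/-- `E4(τ) = 1 + 240·Σ_{n≥1} n³qⁿ/(1−qⁿ)` -/
noncomputable def E4 (τ : ℂ) : ℂ :=
  1 + 240 * ∑' n : ℕ, ((n : ℂ) + 1) ^ 3 * qc τ ^ (n + 1) / (1 - qc τ ^ (n + 1))

/-- `E6(τ) = 1 − 504·Σ_{n≥1} n⁵qⁿ/(1−qⁿ)` -/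
noncomputable def E6 (τ : ℂ) : ℂ :=
  1 - 504 * ∑' n : ℕ, ((n : ℂ) + 1) ^ 5 * qc τ ^ (n + 1) / (1 - qc τ ^ (n + 1))

/-- `Δ = (E4³ − E6²)/1728` -/
noncomputable def Δf (τ : ℂ) : ℂ := (E4 τ ^ 3 - E6 τ ^ 2) / 1728

/-- `a0 = E4/12` -/
noncomputable def a0f (τ : ℂ) : ℂ := E4 τ / 12

/-- `a2 = ΔK²/(4E4) − E6·L/24 + E4·M/24` -/
noncomputable def a2f (τ : ℂ) (z : Fin 4 → ℂ) : ℂ :=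
  Δf τ * Kf τ z ^ 2 / (4 * E4 τ) - E6 τ * Lf τ z / 24 + E4 τ * Mf τ z / 24

/-- `b0 = E6/216` -/
noncomputable def b0f (τ : ℂ) : ℂ := E6 τ / 216

/-- `b1 = ΔK/E4` -/
noncomputable def b1f (τ : ℂ) (z : Fin 4 → ℂ) : ℂ := Δf τ * Kf τ z / E4 τ

/-- `b2 = −E6·ΔK²/(24E4²) − E4²·L/288 + E6·M/288` -/
noncomputable def b2f (τ : ℂ) (z : Fin 4 → ℂ) : ℂ :=
  -(E6 τ * Δf τ * Kf τ z ^ 2) / (24 * E4 τ ^ 2) - E4 τ ^ 2 * Lf τ z / 288 + E6 τ * Mf τ z / 288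

/-- `b3 = −Δ²K³/E4³ + ΔK·M/(4E4) + Δ·N/4` -/
noncomputable def b3f (τ : ℂ) (z : Fin 4 → ℂ) : ℂ :=
  -(Δf τ ^ 2 * Kf τ z ^ 3) / E4 τ ^ 3 + Δf τ * Kf τ z * Mf τ z / (4 * E4 τ) + Δf τ * Nf τ z / 4

/-- The domain `{τ ∈ ℍ : E4(τ) ≠ 0} × ℂ⁴`. -/
def Dom4 : Type := {τ : ℂ // 0 < τ.im ∧ E4 τ ≠ 0} × (Fin 4 → ℂ)

open UpperHalfPlane ModularForm MatrixGroups in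
lemma eisenstein_smul_S_vadd {k : ℕ} (hk : 3 ≤ k) (d : ℕ) (τ : ℍ) :
    E hk (ModularGroup.S • ((d : ℝ) +ᵥ τ)) = ((τ : ℂ) + d) ^ k * E hk τ := by
  have hmem : ((ModularGroup.S : SL(2, ℤ)) : GL (Fin 2) ℝ) ∈ 𝒮ℒ := ⟨ModularGroup.S, rfl⟩
  have hS := SlashInvariantForm.slash_action_eqn'' (E hk) hmem ((d : ℝ) +ᵥ τ)
  have hT := SlashInvariantForm.vAdd_apply_of_mem_strictPeriods (Γ := 𝒮ℒ) (E hk) τ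
    (h := (d : ℝ)) (by simpa [AddSubgroup.mem_zmultiples_iff] using ⟨(d : ℤ), by simp⟩)
  rw [← hT]
  have hd : denom (ModularGroup.S : GL (Fin 2) ℝ) ((d : ℝ) +ᵥ τ) = (τ : ℂ) + d := by
    rw [ModularGroup.denom_S]
    simp [add_comm]
  rw [hd, zpow_natCast] at hS
  exact hS

open UpperHalfPlane ModularForm MatrixGroups in
lemma eval_weighted_eisenstein_eq_zero (F : MvPolynomial (Fin 2) ℂ)
    (h : ∀ τ : ℍ, eval ![E₄ τ, E₆ τ] F = 0) (τ : ℍ) (c : ℂ) :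
    eval ![c ^ 4 * E₄ τ, c ^ 6 * E₆ τ] F = 0 := by
  set p : Polynomial ℂ :=
    aeval ![Polynomial.C (E₄ τ) * Polynomial.X ^ 4, Polynomial.C (E₆ τ) * Polynomial.X ^ 6] F
  have hp : ∀ c, p.eval c = eval ![c ^ 4 * E₄ τ, c ^ 6 * E₆ τ] F := by
    intro c
    have : Polynomial.aeval c p = aeval ![c ^ 4 * E₄ τ, c ^ 6 * E₆ τ] F := by
      rw [← AlgHom.comp_apply, comp_aeval]
      congr 2
      ext i
      fin_cases i <;> simp <;> ring
    simpa [Polynomial.coe_aeval_eq_eval, coe_aeval_eq_eval] using this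
  have hp0 : p = 0 := by
    refine Polynomial.eq_zero_of_infinite_isRoot p (Set.Infinite.mono ?_
      (Set.infinite_range_of_injective (f := fun d : ℕ => (τ : ℂ) + d)
        (fun a b hab => by simpa using hab)))
    rintro _ ⟨d, rfl⟩
    have := h (ModularGroup.S • ((d : ℝ) +ᵥ τ))
    rw [eisenstein_smul_S_vadd, eisenstein_smul_S_vadd] at this
    simpa [Polynomial.IsRoot, hp] using this
  rw [← hp, hp0, Polynomial.eval_zero]

open UpperHalfPlane ModularForm MatrixGroups in
lemma infinite_range_E₄_cube_div_discriminant :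
    (Set.range fun τ : ℍ => E₄ τ ^ 3 / discriminant τ).Infinite := by
  have hcont : Continuous fun τ : ℍ => E₄ τ ^ 3 / discriminant τ := by
    have h1 : Continuous E₄ := (ModularFormClass.holo E₄).continuous
    have h2 : Continuous discriminant := (ModularFormClass.holo CuspForm.discriminant).continuous
    exact (h1.pow 3).div h2 discriminant_ne_zero
  refine (isPreconnected_range hcont).infinite_of_nontrivial ?_
  obtain ⟨τ, hτ⟩ := DFunLike.ne_iff.mp (EisensteinSeries.E_ne_zero (show 3 ≤ 6 by norm_num) ⟨3, rfl⟩)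
  have hI : E₆ UpperHalfPlane.I = 0 := by
    have := eisenstein_smul_S_vadd (show 3 ≤ 6 by norm_num) 0 UpperHalfPlane.I
    have hfix : ModularGroup.S • ((((0 : ℕ) : ℝ)) +ᵥ UpperHalfPlane.I) = UpperHalfPlane.I := by
      rw [modular_S_smul]
      ext
      simp
    rw [hfix] at this
    have h6 : (Complex.I) ^ 6 = -1 := by
      rw [show (6 : ℕ) = 2 * 3 by rfl, pow_mul, Complex.I_sq]; norm_num
    simp only [UpperHalfPlane.coe_I, Nat.cast_zero, add_zero, h6] at this
    linear_combination this / 2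
  refine ⟨_, ⟨UpperHalfPlane.I, rfl⟩, _, ⟨τ, rfl⟩, fun heq => hτ ?_⟩
  have d1 := discriminant_eq_E₄_cube_sub_E₆_sq UpperHalfPlane.I
  have d2 := discriminant_eq_E₄_cube_sub_E₆_sq τ
  have n1 := discriminant_ne_zero UpperHalfPlane.I
  have n2 := discriminant_ne_zero τ
  simp only at heq
  rw [div_eq_div_iff n1 n2] at heq
  rw [hI] at d1
  have h4 : E₄ UpperHalfPlane.I ^ 3 = 1728 * discriminant UpperHalfPlane.I := by
    linear_combination -1728 * d1
  rw [h4] at heq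
  have h5 : E₄ τ ^ 3 = 1728 * discriminant τ := by
    apply mul_right_cancel₀ n1
    linear_combination -heq
  have : E₆ τ ^ 2 = 0 := by linear_combination 1728 * d2 + h5
  simpa using this

open UpperHalfPlane ModularForm MatrixGroups in
lemma eq_zero_of_eval_eisenstein_eq_zero (F : MvPolynomial (Fin 2) ℂ)
    (h : ∀ τ : ℍ, eval ![E₄ τ, E₆ τ] F = 0) : F = 0 := by
  have key : ∀ x : ℂ, x ≠ 0 → ∀ y : ℂ, eval ![x, y] F = 0 := by
    intro x hx
    set p : Polynomial ℂ := aeval ![Polynomial.C x, Polynomial.X] F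
    have hp : ∀ y, p.eval y = eval ![x, y] F := by
      intro y
      have : Polynomial.aeval y p = aeval ![x, y] F := by
        rw [← AlgHom.comp_apply, comp_aeval]
        congr 2
        ext i
        fin_cases i <;> simp
      simpa [Polynomial.coe_aeval_eq_eval, coe_aeval_eq_eval] using this
    suffices hp0 : p = 0 by
      intro y; rw [← hp, hp0, Polynomial.eval_zero]
    refine Polynomial.eq_zero_of_infinite_isRoot p fun hfin => ?_
    have hinf := infinite_range_E₄_cube_div_discriminant.sdiff (Set.finite_singleton (0 : ℂ))
    refine hinf ((hfin.image fun y => x ^ 3 / ((x ^ 3 - y ^ 2) / 1728)).subset ?_)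
    rintro _ ⟨⟨τ, rfl⟩, hτ⟩
    have hE : E₄ τ ≠ 0 := fun h0 => hτ (by simp [h0])
    obtain ⟨c, hc⟩ := IsAlgClosed.exists_pow_nat_eq (x / E₄ τ) (show 0 < 4 by norm_num)
    have hcx : c ^ 4 * E₄ τ = x := by rw [hc, div_mul_cancel₀ _ hE]
    have hc0 : c ≠ 0 := by rintro rfl; apply hx; rw [← hcx]; simp
    refine ⟨c ^ 6 * E₆ τ, ?_, ?_⟩
    · simp only [Set.mem_ofPred_eq, Polynomial.IsRoot, hp, ← hcx]
      exact eval_weighted_eisenstein_eq_zero F h τ c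
    · have e : (x ^ 3 - (c ^ 6 * E₆ τ) ^ 2) / 1728 = c ^ 12 * discriminant τ := by
        rw [discriminant_eq_E₄_cube_sub_E₆_sq, ← hcx]; ring
      simp only [e]
      rw [← hcx, show (c ^ 4 * E₄ τ) ^ 3 = c ^ 12 * E₄ τ ^ 3 by ring,
        mul_div_mul_left _ _ (pow_ne_zero 12 hc0)]
  refine MvPolynomial.funext_set (fun _ => {0}ᶜ) (fun _ => (Set.finite_singleton _).infinite_compl)
    fun v hv => ?_
  have hv' : v = ![v 0, v 1] := by ext i; fin_cases i <;> rfl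
  rw [map_zero, hv']
  exact key _ (hv 0 trivial) _

open UpperHalfPlane ModularForm in
lemma E4_eq_eisenstein (τ : ℍ) : E4 τ = E₄ τ := by
  rw [EisensteinSeries.q_expansion_bernoulli _ ⟨2, rfl⟩]
  have hq : ‖cexp (2 * Real.pi * Complex.I * τ)‖ < 1 := norm_exp_two_pi_I_lt_one τ
  have h := tsum_pow_div_one_sub_eq_tsum_sigma hq 3
  rw [tsum_pnat_eq_tsum_succ (f := fun n : ℕ => (n : ℂ) ^ 3 * cexp (2 * Real.pi * Complex.I * τ) ^ n /
    (1 - cexp (2 * Real.pi * Complex.I * τ) ^ n))] at h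
  simp only [zpow_natCast, E4, qc]
  push_cast at h
  rw [h]
  norm_num [show bernoulli 4 = -1 / 30 by decide +kernel]

open UpperHalfPlane ModularForm in
lemma E6_eq_eisenstein (τ : ℍ) : E6 τ = E₆ τ := by
  rw [EisensteinSeries.q_expansion_bernoulli _ ⟨3, rfl⟩]
  have hq : ‖cexp (2 * Real.pi * Complex.I * τ)‖ < 1 := norm_exp_two_pi_I_lt_one τ
  have h := tsum_pow_div_one_sub_eq_tsum_sigma hq 5
  rw [tsum_pnat_eq_tsum_succ (f := fun n : ℕ => (n : ℂ) ^ 5 * cexp (2 * Real.pi * Complex.I * τ) ^ n /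
    (1 - cexp (2 * Real.pi * Complex.I * τ) ^ n))] at h
  simp only [zpow_natCast, E6, qc]
  push_cast at h
  rw [h]
  norm_num [show bernoulli 6 = 1 / 42 by decide +kernel]

open UpperHalfPlane ModularForm in
lemma eq_zero_of_eval_eisenstein_imaginary_axis (F : MvPolynomial (Fin 2) ℂ) (T : ℝ)
    (h : ∀ t : ℝ, T < t → eval ![E4 (t * Complex.I), E6 (t * Complex.I)] F = 0) : F = 0 := by
  have hdiff : ∀ G : MvPolynomial (Fin 2) ℂ, DifferentiableOn ℂ
      (fun z => eval ![E₄ (ofComplex z), E₆ (ofComplex z)] G) {z | 0 < z.im} := by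
    have h4 := UpperHalfPlane.mdifferentiable_iff.mp (ModularFormClass.holo E₄)
    have h6 := UpperHalfPlane.mdifferentiable_iff.mp (ModularFormClass.holo E₆)
    intro G
    induction G using MvPolynomial.induction_on with
    | C a => simp
    | add p q hp hq => simp only [map_add]; exact hp.add hq
    | mul_X p i hp =>
      fin_cases i
      · simp only [map_mul, eval_X]; exact hp.mul h4
      · simp only [map_mul, eval_X]; exact hp.mul h6
  have hS : IsOpen {z : ℂ | 0 < z.im} := isOpen_upperHalfPlaneSet
  have hconn : IsPreconnected {z : ℂ | 0 < z.im} :=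
    (convex_halfSpace_im_gt 0).isPreconnected
  set t₀ : ℝ := max T 0 + 1
  have hT : T < t₀ := by have := le_max_left T 0; linarith
  have h0 : 0 < t₀ := by have := le_max_right T 0; linarith
  have hmem : (t₀ * Complex.I : ℂ) ∈ {z : ℂ | 0 < z.im} := by simpa using h0
  have hfreq : ∃ᶠ z in nhdsWithin (t₀ * Complex.I : ℂ) {(t₀ * Complex.I : ℂ)}ᶜ,
      eval ![E₄ (ofComplex z), E₆ (ofComplex z)] F = 0 := by
    have htend : Filter.Tendsto (fun t : ℝ => (t * Complex.I : ℂ)) (nhdsWithin t₀ {t₀}ᶜ)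
        (nhdsWithin (t₀ * Complex.I : ℂ) {(t₀ * Complex.I : ℂ)}ᶜ) := by
      refine tendsto_nhdsWithin_iff.mpr ⟨?_, ?_⟩
      · exact (by fun_prop : Continuous fun t : ℝ => (t * Complex.I : ℂ)).continuousAt.tendsto.mono_left
          nhdsWithin_le_nhds
      · filter_upwards [self_mem_nhdsWithin] with t ht
        simpa using ht
    refine htend.frequently (Filter.Eventually.frequently ?_)
    filter_upwards [nhdsWithin_le_nhds (lt_mem_nhds hT), nhdsWithin_le_nhds (lt_mem_nhds h0)]
      with t hTt h0t
    have him : 0 < (t * Complex.I : ℂ).im := by simpa using h0t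
    have := h t hTt
    rwa [show (t * Complex.I : ℂ) = ((⟨t * Complex.I, him⟩ : ℍ) : ℂ) from rfl, E4_eq_eisenstein,
      E6_eq_eisenstein, ← ofComplex_apply_of_im_pos him] at this
  have hzero := ((hdiff F).analyticOnNhd hS).eqOn_zero_of_preconnected_of_frequently_eq_zero
    hconn hmem hfreq
  refine eq_zero_of_eval_eisenstein_eq_zero F fun τ => ?_
  simpa using hzero τ.im_pos

lemma summable_exp_neg_pi_mul_sq {t : ℝ} (ht : 0 < t) :
    Summable fun n : ℤ => Real.exp (-Real.pi * t * n ^ 2) := by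
  have := (summable_jacobiTheta₂_term_iff 0 (t * Complex.I)).mpr (by simpa using ht)
  refine this.norm.congr fun n => ?_
  rw [norm_jacobiTheta₂_term]
  simp
  ring

lemma summable_exp_neg_pi_mul_sub_half_sq {t : ℝ} (ht : 0 < t) :
    Summable fun n : ℤ => Real.exp (-Real.pi * t * (n - 1 / 2) ^ 2) := by
  have := (summable_jacobiTheta₂_term_iff (-(t * Complex.I) / 2) (t * Complex.I)).mpr
    (by simpa using ht)
  refine (this.norm.mul_left (Real.exp (-Real.pi * t / 4))).congr fun n => ?_
  rw [norm_jacobiTheta₂_term, ← Real.exp_add]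
  congr 1
  simp
  ring

lemma theta2_imaginary_axis (t : ℝ) :
    theta2 (t * Complex.I) = ((∑' n : ℤ, Real.exp (-Real.pi * t * (n - 1 / 2) ^ 2) : ℝ) : ℂ) := by
  rw [theta2, Complex.ofReal_tsum]
  refine tsum_congr fun n => ?_
  push_cast
  congr 1
  linear_combination (Real.pi * t * ((n : ℂ) - 1 / 2) ^ 2) * Complex.I_sq

lemma theta3_imaginary_axis (t : ℝ) :
    theta3 (t * Complex.I) = ((∑' n : ℤ, Real.exp (-Real.pi * t * n ^ 2) : ℝ) : ℂ) := by
  rw [theta3, Complex.ofReal_tsum]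
  refine tsum_congr fun n => ?_
  push_cast
  congr 1
  linear_combination (Real.pi * t * (n : ℂ) ^ 2) * Complex.I_sq

lemma theta4_imaginary_axis (t : ℝ) :
    theta4 (t * Complex.I) =
      ((∑' n : ℤ, (-1) ^ n * Real.exp (-Real.pi * t * n ^ 2) : ℝ) : ℂ) := by
  rw [theta4, Complex.ofReal_tsum]
  refine tsum_congr fun n => ?_
  push_cast
  congr 2
  linear_combination (Real.pi * t * (n : ℂ) ^ 2) * Complex.I_sq

lemma exists_tsum_exp_sub_half_sq_lt_one :
    ∃ T : ℝ, 0 < T ∧ ∀ t : ℝ, T < t → ∑' n : ℤ, Real.exp (-Real.pi * t * (n - 1 / 2) ^ 2) < 1 := by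
  set S := ∑' n : ℤ, Real.exp (-Real.pi * 1 * (n - 1 / 2) ^ 2) with hS
  have htend : Filter.Tendsto (fun t : ℝ => Real.exp (-(Real.pi / 4 * (t - 1))) * S) Filter.atTop
      (nhds (0 * S)) := by
    refine Filter.Tendsto.mul_const _ (Real.tendsto_exp_neg_atTop_nhds_zero.comp ?_)
    exact (Filter.tendsto_atTop_add_const_right _ _ Filter.tendsto_id).const_mul_atTop
      (by positivity)
  rw [zero_mul] at htend
  obtain ⟨T, hT⟩ := Filter.eventually_atTop.mp (htend.eventually_lt_const one_pos)
  refine ⟨max T 1, by positivity, fun t ht => ?_⟩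
  have ht1 : 1 < t := (le_max_right _ _).trans_lt ht
  refine lt_of_le_of_lt ?_ (hT t ((le_max_left _ _).trans ht.le))
  rw [hS, ← tsum_mul_left]
  refine (summable_exp_neg_pi_mul_sub_half_sq (by linarith)).tsum_le_tsum (fun n => ?_)
    ((summable_exp_neg_pi_mul_sub_half_sq one_pos).mul_left _)
  rw [← Real.exp_add, Real.exp_le_exp]
  have hn : (1 : ℝ) / 4 ≤ (n - 1 / 2) ^ 2 := by
    have : (0 : ℝ) ≤ n * (n - 1) := by
      have : 0 ≤ n * (n - 1) := by
        rcases le_or_gt n 0 with h | h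
        · exact mul_nonneg_of_nonpos_of_nonpos h (by lia)
        · exact mul_nonneg h.le (by lia)
      exact_mod_cast this
    nlinarith
  nlinarith [mul_nonneg (mul_nonneg Real.pi_pos.le (sub_nonneg.mpr ht1.le)) (sub_nonneg.mpr hn)]

lemma exists_e_pairwise_ne_imaginary_axis :
    ∃ T : ℝ, 0 < T ∧ ∀ t : ℝ, T < t → e1 (t * Complex.I) ≠ e2 (t * Complex.I) ∧
      e1 (t * Complex.I) ≠ e3 (t * Complex.I) ∧ e2 (t * Complex.I) ≠ e3 (t * Complex.I) := by
  obtain ⟨T, hT, hlt⟩ := exists_tsum_exp_sub_half_sq_lt_one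
  refine ⟨T, hT, fun t ht => ?_⟩
  have ht0 : 0 < t := hT.trans ht
  have h2 := theta2_imaginary_axis t
  have h3 := theta3_imaginary_axis t
  have h4 := theta4_imaginary_axis t
  have hs3 := summable_exp_neg_pi_mul_sq ht0
  have hlt' := hlt t ht
  have hpos : 0 < ∑' n : ℤ, Real.exp (-Real.pi * t * (n - 1 / 2) ^ 2) :=
    (summable_exp_neg_pi_mul_sub_half_sq ht0).tsum_pos (fun _ => (Real.exp_pos _).le) 0
      (Real.exp_pos _)
  have h31 : 1 ≤ ∑' n : ℤ, Real.exp (-Real.pi * t * n ^ 2) := by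
    simpa using hs3.le_tsum 0 fun n _ => (Real.exp_pos _).le
  have habs : |∑' n : ℤ, (-1 : ℝ) ^ n * Real.exp (-Real.pi * t * n ^ 2)| ≤
      ∑' n : ℤ, Real.exp (-Real.pi * t * n ^ 2) := by
    rw [← Real.norm_eq_abs]
    refine tsum_of_norm_bounded hs3.hasSum fun n => ?_
    simp
  set a := ∑' n : ℤ, Real.exp (-Real.pi * t * (n - 1 / 2) ^ 2)
  set b := ∑' n : ℤ, Real.exp (-Real.pi * t * n ^ 2)
  set c := ∑' n : ℤ, (-1 : ℝ) ^ n * Real.exp (-Real.pi * t * n ^ 2)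
  have ha4 : 0 < a ^ 4 := by positivity
  have ha1 : a ^ 4 < 1 := pow_lt_one₀ hpos.le hlt' (by norm_num)
  have hb1 : 1 ≤ b ^ 4 := one_le_pow₀ h31
  have hc0 : 0 ≤ c ^ 4 := by positivity
  have hcb : c ^ 4 ≤ b ^ 4 := by
    have := pow_le_pow_left₀ (abs_nonneg c) habs 4
    rwa [Even.pow_abs (by decide)] at this
  simp only [e1, e2, e3, h2, h3, h4]
  refine ⟨fun h => ?_, fun h => ?_, fun h => ?_⟩ <;> norm_cast at h <;> linarith

lemma exists_esymm_four_eq (s₁ s₂ s₃ s₄ : ℂ) : ∃ w₁ w₂ w₃ w₄ : ℂ,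
    w₁ + w₂ + w₃ + w₄ = s₁ ∧
    w₁ * w₂ + w₁ * w₃ + w₁ * w₄ + w₂ * w₃ + w₂ * w₄ + w₃ * w₄ = s₂ ∧
    w₁ * w₂ * w₃ + w₁ * w₂ * w₄ + w₁ * w₃ * w₄ + w₂ * w₃ * w₄ = s₃ ∧
    w₁ * w₂ * w₃ * w₄ = s₄ := by
  obtain ⟨w₁, h₁⟩ := IsAlgClosed.exists_root
    (Polynomial.X ^ 4 - Polynomial.C s₁ * Polynomial.X ^ 3 + Polynomial.C s₂ * Polynomial.X ^ 2 - Polynomial.C s₃ * Polynomial.X + Polynomial.C s₄ : Polynomial ℂ) (by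
      have : (Polynomial.X ^ 4 - Polynomial.C s₁ * Polynomial.X ^ 3 + Polynomial.C s₂ * Polynomial.X ^ 2 - Polynomial.C s₃ * Polynomial.X + Polynomial.C s₄ : Polynomial ℂ).degree = 4 := by
        compute_degree!
      simp [this])
  set t₁ := s₁ - w₁ with ht₁
  set t₂ := s₂ - w₁ * t₁ with ht₂
  set t₃ := s₃ - w₁ * t₂ with ht₃
  obtain ⟨w₂, h₂⟩ := IsAlgClosed.exists_root (Polynomial.X ^ 3 - Polynomial.C t₁ * Polynomial.X ^ 2 + Polynomial.C t₂ * Polynomial.X - Polynomial.C t₃ : Polynomial ℂ) (by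
      have : (Polynomial.X ^ 3 - Polynomial.C t₁ * Polynomial.X ^ 2 + Polynomial.C t₂ * Polynomial.X - Polynomial.C t₃ : Polynomial ℂ).degree = 3 := by compute_degree!
      simp [this])
  set u₁ := t₁ - w₂ with hu₁
  set u₂ := t₂ - w₂ * u₁ with hu₂
  obtain ⟨w₃, h₃⟩ := IsAlgClosed.exists_root (Polynomial.X ^ 2 - Polynomial.C u₁ * Polynomial.X + Polynomial.C u₂ : Polynomial ℂ) (by
      have : (Polynomial.X ^ 2 - Polynomial.C u₁ * Polynomial.X + Polynomial.C u₂ : Polynomial ℂ).degree = 2 := by compute_degree!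
      simp [this])
  simp only [Polynomial.IsRoot, Polynomial.eval_add, Polynomial.eval_sub, Polynomial.eval_mul,
    Polynomial.eval_pow, Polynomial.eval_X, Polynomial.eval_C] at h₁ h₂ h₃
  have e₂ : w₃ * (u₁ - w₃) = u₂ := by linear_combination -h₃
  have e₃ : w₂ * u₂ = t₃ := by linear_combination h₂ + w₂ * hu₂ - w₂ ^ 2 * hu₁
  have e₄ : w₁ * t₃ = s₄ := by
    linear_combination -h₁ + w₁ * ht₃ - w₁ ^ 2 * ht₂ + w₁ ^ 3 * ht₁
  refine ⟨w₁, w₂, w₃, u₁ - w₃, ?_, ?_, ?_, ?_⟩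
  · linear_combination hu₁ + ht₁
  · linear_combination ht₂ + hu₂ + e₂ + w₁ * hu₁
  · linear_combination ht₃ + e₃ + (w₁ + w₂) * e₂ + w₁ * hu₂
  · linear_combination e₄ + w₁ * e₃ + w₁ * w₂ * e₂

lemma fI2_eq (z : Fin 4 → ℂ) : fI2 z = z 0 ^ 2 + z 1 ^ 2 + z 2 ^ 2 + z 3 ^ 2 := by
  simp [fI2, Fin.sum_univ_four]

lemma fI4_eq (z : Fin 4 → ℂ) : fI4 z = z 0 ^ 2 * z 1 ^ 2 + z 0 ^ 2 * z 2 ^ 2 + z 0 ^ 2 * z 3 ^ 2 +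
    z 1 ^ 2 * z 2 ^ 2 + z 1 ^ 2 * z 3 ^ 2 + z 2 ^ 2 * z 3 ^ 2 := by
  simp [fI4, Finset.sum_filter, Fintype.sum_prod_type, Fin.sum_univ_four]
  ring

lemma fI6_eq (z : Fin 4 → ℂ) : fI6 z = z 0 ^ 2 * z 1 ^ 2 * z 2 ^ 2 + z 0 ^ 2 * z 1 ^ 2 * z 3 ^ 2 +
    z 0 ^ 2 * z 2 ^ 2 * z 3 ^ 2 + z 1 ^ 2 * z 2 ^ 2 * z 3 ^ 2 := by
  simp [fI6, Finset.sum_filter, Fintype.sum_prod_type, Fin.sum_univ_four]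

lemma fI4t_eq (z : Fin 4 → ℂ) : fI4t z = z 0 * z 1 * z 2 * z 3 := by
  simp [fI4t, Fin.prod_univ_four]

lemma exists_weyl_invariants_eq (s₁ s₂ s₃ p : ℂ) :
    ∃ z : Fin 4 → ℂ, fI2 z = s₁ ∧ fI4 z = s₂ ∧ fI6 z = s₃ ∧ fI4t z = p := by
  simp only [fI2_eq, fI4_eq, fI6_eq, fI4t_eq]
  obtain ⟨w₁, w₂, w₃, w₄, h₁, h₂, h₃, h₄⟩ := exists_esymm_four_eq s₁ s₂ s₃ (p ^ 2)
  obtain ⟨z₁, rfl⟩ := IsAlgClosed.exists_pow_nat_eq w₁ two_pos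
  obtain ⟨z₂, rfl⟩ := IsAlgClosed.exists_pow_nat_eq w₂ two_pos
  obtain ⟨z₃, rfl⟩ := IsAlgClosed.exists_pow_nat_eq w₃ two_pos
  obtain ⟨z₄, rfl⟩ := IsAlgClosed.exists_pow_nat_eq w₄ two_pos
  have hp : (z₁ * z₂ * z₃ * z₄) ^ 2 = p ^ 2 := by linear_combination h₄
  rcases sq_eq_sq_iff_eq_or_eq_neg.mp hp with h | h
  · exact ⟨![z₁, z₂, z₃, z₄], h₁, h₂, h₃, h⟩
  · refine ⟨![-z₁, z₂, z₃, z₄], ?_, ?_, ?_, ?_⟩ <;>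
      simp only [Matrix.cons_val, neg_sq]
    · exact h₁
    · exact h₂
    · exact h₃
    · linear_combination -h

lemma exists_generators_eq {τ : ℂ} (h₄ : E4 τ ≠ 0) (hΔ : Δf τ ≠ 0) (h₁₂ : e1 τ ≠ e2 τ)
    (h₁₃ : e1 τ ≠ e3 τ) (h₂₃ : e2 τ ≠ e3 τ) (y₀ y₁ y₂ y₃ : ℂ) :
    ∃ z : Fin 4 → ℂ, a2f τ z = y₀ ∧ b1f τ z = y₁ ∧ b2f τ z = y₂ ∧ b3f τ z = y₃ := by
  obtain ⟨K, hK⟩ : ∃ K, Δf τ * K = y₁ * E4 τ := ⟨y₁ * E4 τ / Δf τ, by field_simp⟩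
  obtain ⟨A, hA⟩ : ∃ A, A = y₀ - Δf τ * K ^ 2 / (4 * E4 τ) := ⟨_, rfl⟩
  obtain ⟨B, hB⟩ : ∃ B, B = y₂ + E6 τ * Δf τ * K ^ 2 / (24 * E4 τ ^ 2) := ⟨_, rfl⟩
  have hdet : Δf τ = (E4 τ ^ 3 - E6 τ ^ 2) / 1728 := rfl
  obtain ⟨L, M, hLA, hMB⟩ : ∃ L M, -E6 τ * L / 24 + E4 τ * M / 24 = A ∧
      -E4 τ ^ 2 * L / 288 + E6 τ * M / 288 = B := by
    refine ⟨(A * E6 τ / 288 - B * E4 τ / 24) / (Δf τ / 4),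
      (-E6 τ * B / 24 + E4 τ ^ 2 * A / 288) / (Δf τ / 4), ?_, ?_⟩ <;> field_simp <;>
      rw [hdet] <;> ring
  obtain ⟨N, hN⟩ : ∃ N, -(Δf τ ^ 2 * K ^ 3) / E4 τ ^ 3 + Δf τ * K * M / (4 * E4 τ) +
      Δf τ * N / 4 = y₃ :=
    ⟨(y₃ + Δf τ ^ 2 * K ^ 3 / E4 τ ^ 3 - Δf τ * K * M / (4 * E4 τ)) * 4 / Δf τ, by
      field_simp; ring⟩
  have n₁₂ := sub_ne_zero.mpr h₁₂
  have n₁₃ := sub_ne_zero.mpr h₁₃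
  have n₂₃ := sub_ne_zero.mpr h₂₃
  obtain ⟨T₁, T₂, hTL, hTM⟩ : ∃ T₁ T₂, (e1 τ - e3 τ) * T₁ + (e2 τ - e3 τ) * T₂ = L ∧
      (e1 τ ^ 2 - e3 τ ^ 2) * T₁ + (e2 τ ^ 2 - e3 τ ^ 2) * T₂ = M / 12 := by
    refine ⟨(M / 12 - (e2 τ + e3 τ) * L) / ((e1 τ - e2 τ) * (e1 τ - e3 τ)),
      ((e1 τ + e3 τ) * L - M / 12) / ((e1 τ - e2 τ) * (e2 τ - e3 τ)), ?_, ?_⟩ <;>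
      field_simp <;> ring
  obtain ⟨I₄, hI₄⟩ : ∃ I₄, I₄ = 6 * T₁ + K ^ 2 / 4 := ⟨_, rfl⟩
  obtain ⟨z, z₂, z₄, z₆, zt⟩ := exists_weyl_invariants_eq K I₄
    (4 * (N + K * I₄ / 24 - K ^ 3 / 96)) (-2 * (T₂ + I₄ / 12 - K ^ 2 / 48))
  have hT₁ : fT1 z = T₁ := by rw [fT1, z₂, z₄, hI₄]; ring
  have hT₂ : fT2 z = T₂ := by rw [fT2, z₂, z₄, zt]; ring
  have hT₃ : fT3 z = -T₁ - T₂ := by rw [fT3, z₂, z₄, zt, hI₄]; ring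
  have hKz : Kf τ z = K := z₂
  have hLz : Lf τ z = L := by rw [Lf, hT₁, hT₂, hT₃]; linear_combination hTL
  have hMz : Mf τ z = M := by rw [Mf, hT₁, hT₂, hT₃]; linear_combination 12 * hTM
  have hNz : Nf τ z = N := by rw [Nf, z₂, z₄, z₆]; ring
  refine ⟨z, ?_, ?_, ?_, ?_⟩
  · rw [a2f, hKz, hLz, hMz]; linear_combination hLA + hA
  · rw [b1f, hKz, hK, mul_div_cancel_right₀ _ h₄]
  · rw [b2f, hKz, hLz, hMz]; linear_combination hMB + hB
  · rw [b3f, hKz, hMz, hNz, hN]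

open UpperHalfPlane ModularForm in
lemma Δf_ne_zero (τ : ℍ) : Δf τ ≠ 0 := by
  rw [Δf, E4_eq_eisenstein, E6_eq_eisenstein, ← discriminant_eq_E₄_cube_sub_E₆_sq]
  exact discriminant_ne_zero τ

/-- The six functions `a0, a2, b0, b1, b2, b3`, as elements of the ℂ-algebra of functions
`{τ ∈ ℍ : E4(τ) ≠ 0} × ℂ⁴ → ℂ`, are algebraically independent over ℂ. -/
theorem stmt_6 :
    AlgebraicIndependent ℂ
      (![fun p : Dom4 => a0f p.1.1, fun p => a2f p.1.1 p.2, fun p => b0f p.1.1,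
          fun p => b1f p.1.1 p.2, fun p => b2f p.1.1 p.2, fun p => b3f p.1.1 p.2] :
        Fin 6 → (Dom4 → ℂ)) := by
  rw [algebraicIndependent_iff]
  intro P hP
  obtain ⟨T, hT, he⟩ := exists_e_pairwise_ne_imaginary_axis
  have hrel : ∀ p : Dom4, eval ![a0f p.1.1, a2f p.1.1 p.2, b0f p.1.1, b1f p.1.1 p.2,
      b2f p.1.1 p.2, b3f p.1.1 p.2] P = 0 := by
    intro p
    have := congrArg (Pi.evalAlgHom ℂ (fun _ : Dom4 => ℂ) p) hP
    rw [← AlgHom.comp_apply, comp_aeval, map_zero] at this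
    rw [aeval_eq_eval] at this
    refine (congrArg (fun w => eval w P) ?_).trans this
    funext i
    fin_cases i <;> rfl
  refine MvPolynomial.funext fun v => ?_
  set F : MvPolynomial (Fin 2) ℂ :=
    aeval ![C (1 / 12) * X 0, C (v 1), C (1 / 216) * X 1, C (v 3), C (v 4), C (v 5)] P
  have hF : ∀ x y, eval ![x, y] F = eval ![x / 12, v 1, y / 216, v 3, v 4, v 5] P := by
    intro x y
    have : aeval ![x, y] F = aeval ![x / 12, v 1, y / 216, v 3, v 4, v 5] P := by
      rw [← AlgHom.comp_apply, comp_aeval]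
      congr 2
      ext i
      fin_cases i <;> simp <;> ring
    simpa [coe_aeval_eq_eval] using this
  have hXF : X 0 * F = 0 := by
    refine eq_zero_of_eval_eisenstein_imaginary_axis _ T fun t ht => ?_
    rw [map_mul, eval_X, hF]
    by_cases h4 : E4 (t * Complex.I) = 0
    · simp [h4]
    have him : 0 < (t * Complex.I : ℂ).im := by simpa using hT.trans ht
    obtain ⟨h₁₂, h₁₃, h₂₃⟩ := he t ht
    obtain ⟨z, h1, h3, h4', h5⟩ := exists_generators_eq h4 (Δf_ne_zero ⟨_, him⟩) h₁₂ h₁₃ h₂₃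
      (v 1) (v 3) (v 4) (v 5)
    have := hrel ⟨⟨t * Complex.I, him, h4⟩, z⟩
    simp only [h1, h3, h4', h5] at this
    exact mul_eq_zero_of_right _ this
  have hF0 : F = 0 := (mul_eq_zero.mp hXF).resolve_left (X_ne_zero 0)
  have hv : v = ![12 * v 0 / 12, v 1, 216 * v 2 / 216, v 3, v 4, v 5] := by
    ext i
    fin_cases i <;> simp
  rw [map_zero, hv, ← hF, hF0, map_zero]
end

section
/- For every τ in the upper half-plane ℍ, the functions e1, e2, e3 satisfy e1(−1/τ) = τ²·e3(τ), e2(−1/τ) = τ²·e2(τ), and e3(−1/τ) = τ²·e1(τ); equivalently, θ3(−1/τ)⁴ + θ4(−1/τ)⁴ = −τ²·(θ2(τ)⁴ + θ3(τ)⁴), θ2(−1/τ)⁴ − θ4(−1/τ)⁴ = τ²·(θ2(τ)⁴ − θ4(τ)⁴), and θ2(−1/τ)⁴ + θ3(−1/τ)⁴ = −τ²·(θ3(τ)⁴ + θ4(τ)⁴). -/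
open MvPolynomial Complex

lemma theta2_eq_jacobiTheta₂ (τ : ℂ) :
    theta2 τ = Complex.exp (Real.pi * Complex.I * τ / 4) * jacobiTheta₂ (-τ / 2) τ := by
  rw [theta2, jacobiTheta₂, ← tsum_mul_left]
  refine tsum_congr fun n => ?_
  rw [jacobiTheta₂_term, ← Complex.exp_add]
  ring_nf

lemma theta3_eq_jacobiTheta₂ (τ : ℂ) : theta3 τ = jacobiTheta₂ 0 τ := by
  refine tsum_congr fun n => ?_
  rw [jacobiTheta₂_term]
  ring_nf

lemma theta4_eq_jacobiTheta₂ (τ : ℂ) : theta4 τ = jacobiTheta₂ (1 / 2) τ := by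
  refine tsum_congr fun n => ?_
  rw [jacobiTheta₂_term, Complex.exp_add, ← Complex.exp_pi_mul_I, ← Complex.exp_int_mul]
  ring_nf

lemma neg_I_mul_cpow_half_pow_four (τ : ℂ) :
    ((-Complex.I * τ) ^ (1 / 2 : ℂ)) ^ 4 = -τ ^ 2 := by
  have h : ((-Complex.I * τ) ^ (1 / 2 : ℂ)) ^ 2 = -Complex.I * τ := by
    simp
  rw [show 4 = 2 * 2 from rfl, pow_mul, h, mul_pow, neg_sq, Complex.I_sq]
  ring

lemma neg_I_mul_cpow_half_ne_zero {τ : ℂ} (hτ : τ ≠ 0) :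
    (-Complex.I * τ) ^ (1 / 2 : ℂ) ≠ 0 := by
  simp [Complex.cpow_eq_zero_iff, hτ]

lemma theta2_neg_one_div {τ : ℂ} (hτ : τ ≠ 0) :
    theta2 (-1 / τ) = (-Complex.I * τ) ^ (1 / 2 : ℂ) * theta4 τ := by
  rw [theta2_eq_jacobiTheta₂, theta4_eq_jacobiTheta₂, jacobiTheta₂_functional_equation (1 / 2) τ,
    ← mul_assoc, ← mul_assoc, mul_one_div_cancel (neg_I_mul_cpow_half_ne_zero hτ), one_mul]
  congr 2 <;> field_simp
  all_goals norm_num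

lemma theta3_neg_one_div {τ : ℂ} (hτ : τ ≠ 0) :
    theta3 (-1 / τ) = (-Complex.I * τ) ^ (1 / 2 : ℂ) * theta3 τ := by
  rw [theta3_eq_jacobiTheta₂, theta3_eq_jacobiTheta₂, jacobiTheta₂_functional_equation 0 τ,
    ← mul_assoc, ← mul_assoc, mul_one_div_cancel (neg_I_mul_cpow_half_ne_zero hτ)]
  simp

lemma theta4_neg_one_div {τ : ℂ} (hτ : τ ≠ 0) :
    theta4 (-1 / τ) = (-Complex.I * τ) ^ (1 / 2 : ℂ) * theta2 τ := by
  have hexp : Complex.exp (Real.pi * Complex.I * τ / 4) *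
      Complex.exp (-Real.pi * Complex.I * (-τ / 2) ^ 2 / τ) = 1 := by
    rw [← Complex.exp_add, ← Complex.exp_zero]
    congr 1
    field_simp
    ring
  have hz : -τ / 2 / τ = -(1 / 2) := by field_simp
  have hc := neg_I_mul_cpow_half_ne_zero hτ
  rw [theta2_eq_jacobiTheta₂, theta4_eq_jacobiTheta₂, jacobiTheta₂_functional_equation (-τ / 2),
    hz, jacobiTheta₂_neg_left]
  linear_combination (-jacobiTheta₂ (1 / 2) (-1 / τ)) * hexp -
    Complex.exp (Real.pi * Complex.I * τ / 4) *
      Complex.exp (-Real.pi * Complex.I * (-τ / 2) ^ 2 / τ) *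
      jacobiTheta₂ (1 / 2) (-1 / τ) * mul_one_div_cancel hc

/-- The `S`-transformation laws: `e1(−1/τ) = τ²e3(τ)`, `e2(−1/τ) = τ²e2(τ)`,
`e3(−1/τ) = τ²e1(τ)`, together with their equivalent theta-constant forms. -/
theorem stmt_18 (τ : ℂ) (hτ : 0 < τ.im) :
    e1 (-1 / τ) = τ ^ 2 * e3 τ ∧
    e2 (-1 / τ) = τ ^ 2 * e2 τ ∧
    e3 (-1 / τ) = τ ^ 2 * e1 τ ∧
    theta3 (-1 / τ) ^ 4 + theta4 (-1 / τ) ^ 4 = -τ ^ 2 * (theta2 τ ^ 4 + theta3 τ ^ 4) ∧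
    theta2 (-1 / τ) ^ 4 - theta4 (-1 / τ) ^ 4 = τ ^ 2 * (theta2 τ ^ 4 - theta4 τ ^ 4) ∧
    theta2 (-1 / τ) ^ 4 + theta3 (-1 / τ) ^ 4 = -τ ^ 2 * (theta3 τ ^ 4 + theta4 τ ^ 4) := by
  have h0 : τ ≠ 0 := by
    rintro rfl
    simp at hτ
  have hc := neg_I_mul_cpow_half_pow_four τ
  simp only [e1, e2, e3, theta2_neg_one_div h0, theta3_neg_one_div h0, theta4_neg_one_div h0,
    mul_pow, hc]
  refine ⟨?_, ?_, ?_, ?_, ?_, ?_⟩ <;> ring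
end
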